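/- Let N and G be positive integers with G ≤ N, let a₁, …, a_N be vectors in a finite-dimensional real inner product space, and let ā = (1/N)·∑_{i=1}^N a_i. Then the average, over all subsets S of {1, …, N} of cardinality G (each subset weighted equally, i.e. with weight 1/C(N,G) where C(N,G) is the binomial coefficient), of ‖(1/G)·∑_{i∈S} a_i‖² is at most ‖ā‖² + (1/(G·N))·∑_{i=1}^N ‖a_i − ā‖²; moreover, for every vector b in the space, ∑_{i=1}^N ‖a_i − ā‖² ≤ ∑_{i=1}^N ‖a_i − b‖², so the average is also at most ‖ā‖² + (1/(G·N))·∑_{i=1}^N ‖a_i − b‖². -/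

import Mathlib

open Finset in
/-- Subsets of size `G` containing a given element. -/
lemma aux_cnt1 (N G : ℕ) (hG : 0 < G) (i : Fin N) :
    (((powersetCard G (univ : Finset (Fin N))).filter (fun S => i ∈ S)).card)
      = (N - 1).choose (G - 1) := by
  have h := card_filter_powersetCard_subset ({i} : Finset (Fin N)) univ G (subset_univ _)
    (by rw [card_singleton]; exact hG)
  simpa using h

open Finset in
/-- Subsets of size `G` containing two given distinct elements. -/
lemma aux_cnt2 (N G : ℕ) : ∃ q : ℕ, ∀ i j : Fin N, i ≠ j →
    (((powersetCard G (univ : Finset (Fin N))).filter (fun S => i ∈ S ∧ j ∈ S)).card) = q := by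
  by_cases hG : 2 ≤ G
  · refine ⟨(N - 2).choose (G - 2), fun i j hij => ?_⟩
    have h := card_filter_powersetCard_subset ({i, j} : Finset (Fin N)) univ G (subset_univ _)
      (by rw [card_pair hij]; exact hG)
    rw [card_pair hij] at h
    simpa [insert_subset_iff] using h
  · refine ⟨0, fun i j hij => ?_⟩
    rw [card_eq_zero, filter_eq_empty_iff]
    rintro S hS ⟨hi, hj⟩
    have hS' := (mem_powersetCard.1 hS).2
    have : ({i, j} : Finset (Fin N)).card ≤ S.card := card_le_card (by
      intro k hk
      simp only [mem_insert, mem_singleton] at hk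
      rcases hk with rfl | rfl <;> assumption)
    rw [card_pair hij] at this
    omega

open Finset in
lemma aux_sum1 {E : Type*} [NormedAddCommGroup E] [InnerProductSpace ℝ E]
    (N G : ℕ) (hG : 0 < G) (x : Fin N → E) (hx : ∑ i, x i = 0) :
    ∑ S ∈ powersetCard G (univ : Finset (Fin N)), ∑ i ∈ S, x i = 0 := by
  have h1 : ∀ S : Finset (Fin N), ∑ i ∈ S, x i = ∑ i, if i ∈ S then x i else 0 := by
    intro S; simp
  simp_rw [h1]
  rw [sum_comm]
  have h2 : ∀ i : Fin N, (∑ S ∈ powersetCard G (univ : Finset (Fin N)), if i ∈ S then x i else 0)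
      = ((N - 1).choose (G - 1)) • x i := by
    intro i
    rw [← sum_filter, sum_const, aux_cnt1 N G hG i]
  simp_rw [h2]
  rw [← smul_sum, hx, smul_zero]

open Finset in
lemma aux_sum2 {E : Type*} [NormedAddCommGroup E] [InnerProductSpace ℝ E]
    (N G : ℕ) (hG : 0 < G) (x : Fin N → E) (hx : ∑ i, x i = 0) :
    ∑ S ∈ powersetCard G (univ : Finset (Fin N)), ‖∑ i ∈ S, x i‖ ^ 2
      ≤ ((N - 1).choose (G - 1) : ℝ) * ∑ i, ‖x i‖ ^ 2 := by
  obtain ⟨q, hq⟩ := aux_cnt2 N G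
  have h1 : ∀ S : Finset (Fin N), ‖∑ i ∈ S, x i‖ ^ 2
      = ∑ i, ∑ j, if i ∈ S ∧ j ∈ S then inner ℝ (x i) (x j) else 0 := by
    intro S
    rw [← real_inner_self_eq_norm_sq, sum_inner]
    simp_rw [inner_sum]
    have h0 : ∀ i, (∑ j, if i ∈ S ∧ j ∈ S then inner ℝ (x i) (x j) else 0)
        = if i ∈ S then ∑ j ∈ S, inner ℝ (x i) (x j) else 0 := by
      intro i
      by_cases hi : i ∈ S <;> simp [hi]
    simp_rw [h0]
    simp
  simp_rw [h1]
  rw [sum_comm]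
  have h2 : ∀ i j : Fin N, (∑ S ∈ powersetCard G (univ : Finset (Fin N)),
      if i ∈ S ∧ j ∈ S then inner ℝ (x i) (x j) else 0)
      = (q : ℝ) * inner ℝ (x i) (x j)
        + if i = j then (((N - 1).choose (G - 1) : ℝ) - q) * ‖x i‖ ^ 2 else 0 := by
    intro i j
    rw [← sum_filter, sum_const, nsmul_eq_mul]
    split_ifs with hij
    · subst hij
      simp only [and_self]
      rw [aux_cnt1 N G hG i, real_inner_self_eq_norm_sq]
      ring
    · rw [hq i j hij, add_zero]
  have h3 : ∀ i : Fin N, (∑ S ∈ powersetCard G (univ : Finset (Fin N)),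
      ∑ j, if i ∈ S ∧ j ∈ S then inner ℝ (x i) (x j) else 0)
      = (((N - 1).choose (G - 1) : ℝ) - q) * ‖x i‖ ^ 2 := by
    intro i
    rw [sum_comm]
    simp_rw [h2]
    rw [sum_add_distrib, ← mul_sum, ← inner_sum, hx]
    simp
  simp_rw [h3]
  rw [← mul_sum]
  have h4 : (0 : ℝ) ≤ ∑ i, ‖x i‖ ^ 2 := sum_nonneg (fun i _ => by positivity)
  have h5 : (0 : ℝ) ≤ q := by positivity
  nlinarith

/-- Second-moment bound for uniform sampling of a size-`G` subset of `{1,…,N}`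
without replacement (Lemma 10 of the paper). -/
theorem sampling_second_moment_bound
    {E : Type*} [NormedAddCommGroup E] [InnerProductSpace ℝ E]
    [FiniteDimensional ℝ E]
    (N G : ℕ) (hN : 0 < N) (hG : 0 < G) (hGN : G ≤ N)
    (a : Fin N → E) (abar : E) (habar : abar = (N : ℝ)⁻¹ • ∑ i, a i) :
    ((1 : ℝ) / (N.choose G)) *
        ∑ S ∈ Finset.powersetCard G (Finset.univ : Finset (Fin N)),
          ‖(G : ℝ)⁻¹ • ∑ i ∈ S, a i‖ ^ 2
      ≤ ‖abar‖ ^ 2 + (1 / ((G : ℝ) * N)) * ∑ i, ‖a i - abar‖ ^ 2 ∧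
    (∀ b : E, ∑ i, ‖a i - abar‖ ^ 2 ≤ ∑ i, ‖a i - b‖ ^ 2) ∧
    (∀ b : E, ((1 : ℝ) / (N.choose G)) *
        ∑ S ∈ Finset.powersetCard G (Finset.univ : Finset (Fin N)),
          ‖(G : ℝ)⁻¹ • ∑ i ∈ S, a i‖ ^ 2
      ≤ ‖abar‖ ^ 2 + (1 / ((G : ℝ) * N)) * ∑ i, ‖a i - b‖ ^ 2) := by
  have hNR : (0 : ℝ) < N := by exact_mod_cast hN
  have hGR : (0 : ℝ) < G := by exact_mod_cast hG
  have hx : ∑ i, (a i - abar) = 0 := by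
    rw [Finset.sum_sub_distrib, Finset.sum_const, Finset.card_univ, Fintype.card_fin, habar,
      ← Nat.cast_smul_eq_nsmul ℝ, smul_smul, mul_inv_cancel₀ hNR.ne', one_smul, sub_self]
  have hA : ((1 : ℝ) / (N.choose G)) *
        ∑ S ∈ Finset.powersetCard G (Finset.univ : Finset (Fin N)),
          ‖(G : ℝ)⁻¹ • ∑ i ∈ S, a i‖ ^ 2
      ≤ ‖abar‖ ^ 2 + (1 / ((G : ℝ) * N)) * ∑ i, ‖a i - abar‖ ^ 2 := by
    have e1 : ∀ S ∈ Finset.powersetCard G (Finset.univ : Finset (Fin N)),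
        ‖(G : ℝ)⁻¹ • ∑ i ∈ S, a i‖ ^ 2
        = ‖abar‖ ^ 2 + 2 * (G : ℝ)⁻¹ * inner ℝ abar (∑ i ∈ S, (a i - abar))
          + ((G : ℝ)⁻¹) ^ 2 * ‖∑ i ∈ S, (a i - abar)‖ ^ 2 := by
      intro S hS
      have hc := (Finset.mem_powersetCard.1 hS).2
      have : (G : ℝ)⁻¹ • ∑ i ∈ S, a i = abar + (G : ℝ)⁻¹ • ∑ i ∈ S, (a i - abar) := by
        rw [Finset.sum_sub_distrib, Finset.sum_const, hc, ← Nat.cast_smul_eq_nsmul ℝ, smul_sub,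
          smul_smul, inv_mul_cancel₀ hGR.ne', one_smul]
        abel
      rw [this, norm_add_sq_real, inner_smul_right, norm_smul, mul_pow, Real.norm_eq_abs, sq_abs]
      ring
    rw [Finset.sum_congr rfl e1, Finset.sum_add_distrib, Finset.sum_add_distrib,
      ← Finset.mul_sum, ← Finset.mul_sum, ← inner_sum, aux_sum1 N G hG _ hx, inner_zero_right,
      Finset.sum_const, Finset.card_powersetCard, Finset.card_univ, Fintype.card_fin,
      nsmul_eq_mul, mul_zero, add_zero]
    have e2 := aux_sum2 N G hG _ hx
    have hC : (0 : ℝ) < (N.choose G : ℝ) := by exact_mod_cast Nat.choose_pos hGN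
    have e3 : (N : ℝ) * ((N - 1).choose (G - 1) : ℝ) = (N.choose G : ℝ) * G := by
      obtain ⟨n, rfl⟩ : ∃ n, N = n + 1 := ⟨N - 1, by omega⟩
      obtain ⟨g, rfl⟩ : ∃ g, G = g + 1 := ⟨G - 1, by omega⟩
      have := Nat.add_one_mul_choose_eq n g
      simp only [Nat.add_sub_cancel]
      exact_mod_cast this
    have e4 : ((N - 1).choose (G - 1) : ℝ) = (N.choose G : ℝ) * G / N := by
      rw [eq_div_iff hNR.ne', ← e3]; ring
    rw [e4] at e2
    calc _ ≤ ((1 : ℝ) / (N.choose G)) * ((N.choose G : ℝ) * ‖abar‖ ^ 2 + ((G : ℝ)⁻¹) ^ 2 *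
          ((N.choose G : ℝ) * G / N * ∑ i, ‖a i - abar‖ ^ 2)) := by gcongr
      _ = _ := by field_simp
  have hB : ∀ b : E, ∑ i, ‖a i - abar‖ ^ 2 ≤ ∑ i, ‖a i - b‖ ^ 2 := by
    intro b
    have e1 : ∀ i, ‖a i - b‖ ^ 2 = ‖a i - abar‖ ^ 2 + 2 * inner ℝ (a i - abar) (abar - b)
        + ‖abar - b‖ ^ 2 := by
      intro i
      rw [← norm_add_sq_real, sub_add_sub_cancel]
    simp_rw [e1]
    rw [Finset.sum_add_distrib, Finset.sum_add_distrib, ← Finset.mul_sum, ← sum_inner, hx,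
      inner_zero_left, mul_zero, add_zero]
    exact le_add_of_nonneg_right (Finset.sum_nonneg fun i _ => by positivity)
  refine ⟨hA, hB, fun b => hA.trans ?_⟩
  have := hB b
  gcongr ‖abar‖ ^ 2 + 1 / ((G : ℝ) * N) * ?_
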